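/- Let p_H be a probability density on ℝ^n and ε > 0. Then there exist a symmetric positive definite Σ ∈ ℝ^{n×n}, a compactly supported probability measure μ on ℝ^n, and T > 0 such that, writing p(x) = ∫ φ_Σ(x − y) dμ(y) and letting p_t denote the VP marginals with p_0 = p and v the associated probability-flow vector field: (a) for every t ∈ [0,T], p_t is strictly positive, log p_t is twice differentiable, and sup_{t∈[0,T]} sup_{x∈ℝ^n} ‖∇² log p_t(x)‖ < ∞; and (b) every bijection φ : ℝ^n → ℝ^n which is a flow map of v from time 0 to time T and transports p to p_T is bi-Lipschitz and satisfies ‖p_H·λ − (φ^{-1})_# γ_n‖_TV < ε. -/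

import Mathlib

open MeasureTheory Real Filter Set
open scoped ENNReal Topology RealInnerProductSpace Classical

noncomputable section

/-- Gaussian density kernel with covariance `s2 • I`. -/
def gaussKernel (n : ℕ) (s2 : ℝ) (z : EuclideanSpace ℝ (Fin n)) : ℝ :=
  (2 * π * s2) ^ (-(n : ℝ) / 2) * Real.exp (-‖z‖ ^ 2 / (2 * s2))

/-- VP diffusion marginal `p_t`, with `p_0 = p_H`. -/
def vpMarginal (n : ℕ) (pH : EuclideanSpace ℝ (Fin n) → ℝ) (t : ℝ)
    (x : EuclideanSpace ℝ (Fin n)) : ℝ :=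
  if t = 0 then pH x
  else ∫ y, pH y * gaussKernel n (1 - Real.exp (-t)) (x - Real.exp (-t / 2) • y)

/-- The measure with Lebesgue density `p`. -/
def densMeasure (n : ℕ) (p : EuclideanSpace ℝ (Fin n) → ℝ) :
    Measure (EuclideanSpace ℝ (Fin n)) :=
  volume.withDensity fun x => ENNReal.ofReal (p x)

/-- The standard Gaussian measure `γ_n`. -/
def stdGaussian (n : ℕ) : Measure (EuclideanSpace ℝ (Fin n)) :=
  densMeasure n (gaussKernel n 1)

/-- Score function `s_t = ∇ log p_t`. -/
def score (n : ℕ) (pH : EuclideanSpace ℝ (Fin n) → ℝ) (t : ℝ)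
    (x : EuclideanSpace ℝ (Fin n)) : EuclideanSpace ℝ (Fin n) :=
  gradient (fun z => Real.log (vpMarginal n pH t z)) x

/-- Probability-flow vector field `v_t(x) = -x/2 - s_t(x)/2`. -/
def vField (n : ℕ) (pH : EuclideanSpace ℝ (Fin n) → ℝ) (t : ℝ)
    (x : EuclideanSpace ℝ (Fin n)) : EuclideanSpace ℝ (Fin n) :=
  -(2 : ℝ)⁻¹ • x - (2 : ℝ)⁻¹ • score n pH t x

/-- `φ` is a flow map of `v` from time `s` to time `T`. -/
def IsFlowMap (n : ℕ)
    (v : ℝ → EuclideanSpace ℝ (Fin n) → EuclideanSpace ℝ (Fin n)) (s T : ℝ)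
    (φ : EuclideanSpace ℝ (Fin n) → EuclideanSpace ℝ (Fin n)) : Prop :=
  ∀ x, ∃ γ : ℝ → EuclideanSpace ℝ (Fin n),
    γ s = x ∧ (∀ t ∈ Set.Icc s T, HasDerivAt γ (v t (γ t)) t) ∧ γ T = φ x

/-- Total variation norm `‖μ - ν‖_TV` of the difference of two finite measures. -/
def tvDist {α : Type*} [MeasurableSpace α] (μ ν : Measure α) : ℝ≥0∞ :=
  (⨆ (s : Set α) (_ : MeasurableSet s), μ s - ν s) +
    (⨆ (s : Set α) (_ : MeasurableSet s), ν s - μ s)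

/-- Kullback–Leibler divergence. -/
def klDiv {α : Type*} [MeasurableSpace α] (μ ν : Measure α) : ℝ≥0∞ :=
  if μ ≪ ν ∧ Integrable (llr μ ν) μ then ENNReal.ofReal (∫ x, llr μ ν x ∂μ) else ⊤

/-- A real function is twice differentiable. -/
def TwiceDiff {E : Type*} [NormedAddCommGroup E] [NormedSpace ℝ E] (f : E → ℝ) : Prop :=
  Differentiable ℝ f ∧ Differentiable ℝ (fderiv ℝ f)

/-- Hessian of a real function as a continuous bilinear map. -/
def hessian {E : Type*} [NormedAddCommGroup E] [NormedSpace ℝ E] (f : E → ℝ) (x : E) :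
    E →L[ℝ] E →L[ℝ] ℝ :=
  fderiv ℝ (fderiv ℝ f) x

/-- A map is bi-Lipschitz. -/
def BiLipschitz {E : Type*} [NormedAddCommGroup E] (φ : E → E) : Prop :=
  ∃ c C : ℝ, 0 < c ∧ c ≤ C ∧
    ∀ x y, c * ‖x - y‖ ≤ ‖φ x - φ y‖ ∧ ‖φ x - φ y‖ ≤ C * ‖x - y‖

/-- Centered Gaussian density with covariance matrix `S`. -/
def gaussMat (n : ℕ) (S : Matrix (Fin n) (Fin n) ℝ) (z : EuclideanSpace ℝ (Fin n)) : ℝ :=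
  ((2 * π) ^ n * S.det) ^ (-(1 : ℝ) / 2) *
    Real.exp (-(∑ i, z i * S⁻¹.mulVec (fun j => z j) i) / 2)

end

theorem gk_pos (n : ℕ) {s : ℝ} (hs : 0 < s) (z : EuclideanSpace ℝ (Fin n)) :
    0 < gaussKernel n s z := by
  unfold gaussKernel; positivity

theorem gk_cont (n : ℕ) (s : ℝ) : Continuous (gaussKernel n s) := by
  unfold gaussKernel; fun_prop

theorem gk_le (n : ℕ) {s : ℝ} (hs : 0 < s) (z : EuclideanSpace ℝ (Fin n)) :
    gaussKernel n s z ≤ (2 * π * s) ^ (-(n : ℝ) / 2) := by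
  unfold gaussKernel
  have h1 : Real.exp (-‖z‖ ^ 2 / (2 * s)) ≤ 1 := by
    rw [Real.exp_le_one_iff]
    apply div_nonpos_of_nonpos_of_nonneg
    · nlinarith [sq_nonneg ‖z‖]
    · positivity
  have h2 : 0 < (2 * π * s) ^ (-(n : ℝ) / 2) := by positivity
  nlinarith

theorem gk_integral (n : ℕ) {s : ℝ} (hs : 0 < s) :
    ∫ z, gaussKernel n s z = 1 := by
  unfold gaussKernel
  rw [integral_const_mul]
  have h := GaussianFourier.integral_rexp_neg_mul_sq_norm
    (V := EuclideanSpace ℝ (Fin n)) (b := (2 * s)⁻¹) (by positivity)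
  have e : ∀ v : EuclideanSpace ℝ (Fin n), -‖v‖ ^ 2 / (2 * s) = -(2 * s)⁻¹ * ‖v‖ ^ 2 := by
    intro v; field_simp
  simp_rw [e]
  rw [h]
  simp only [finrank_euclideanSpace, Fintype.card_fin]
  rw [show π / (2 * s)⁻¹ = 2 * π * s by field_simp, ← Real.rpow_add (by positivity)]
  rw [show -(n : ℝ) / 2 + n / 2 = 0 by ring, Real.rpow_zero]

theorem gk_integrable (n : ℕ) {s : ℝ} (hs : 0 < s) :
    Integrable (gaussKernel n s) := by
  by_contra h
  have := gk_integral n hs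
  rw [integral_undef h] at this
  exact zero_ne_one this

theorem gk_mul (n : ℕ) {s τ a : ℝ} (hs : 0 < s) (hτ : 0 < τ)
    (x y z : EuclideanSpace ℝ (Fin n)) :
    gaussKernel n s (y - z) * gaussKernel n τ (x - a • y) =
      gaussKernel n (a ^ 2 * s + τ) (x - a • z) *
      gaussKernel n (s * τ / (a ^ 2 * s + τ))
        (y - (z + (a * s / (a ^ 2 * s + τ)) • (x - a • z))) := by
  have hr : 0 < a ^ 2 * s + τ := by positivity
  obtain ⟨w, rfl⟩ : ∃ w, y = z + w := ⟨y - z, by abel⟩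
  obtain ⟨u, rfl⟩ : ∃ u, x = a • z + u := ⟨x - a • z, by abel⟩
  have e1 : z + w - z = w := by abel
  have e2 : a • z + u - a • (z + w) = u - a • w := by rw [smul_add]; abel
  have e3 : a • z + u - a • z = u := by abel
  rw [e1, e2, e3]
  have e4 : z + w - (z + (a * s / (a ^ 2 * s + τ)) • u) = w - (a * s / (a ^ 2 * s + τ)) • u := by
    abel
  rw [e4]
  unfold gaussKernel
  have hc : (2 * π * s) ^ (-(n : ℝ) / 2) * (2 * π * τ) ^ (-(n : ℝ) / 2) =
      (2 * π * (a ^ 2 * s + τ)) ^ (-(n : ℝ) / 2) *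
      (2 * π * (s * τ / (a ^ 2 * s + τ))) ^ (-(n : ℝ) / 2) := by
    rw [← Real.mul_rpow (by positivity) (by positivity),
      ← Real.mul_rpow (by positivity) (by positivity)]
    congr 1
    field_simp
  have he : -‖w‖ ^ 2 / (2 * s) + -‖u - a • w‖ ^ 2 / (2 * τ) =
      -‖u‖ ^ 2 / (2 * (a ^ 2 * s + τ)) +
      -‖w - (a * s / (a ^ 2 * s + τ)) • u‖ ^ 2 / (2 * (s * τ / (a ^ 2 * s + τ))) := by
    rw [norm_sub_sq_real, norm_sub_sq_real]
    simp only [norm_smul, inner_smul_right, mul_pow, Real.norm_eq_abs, sq_abs]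
    rw [real_inner_comm w u]
    field_simp
    ring
  calc _ = ((2 * π * s) ^ (-(n : ℝ) / 2) * (2 * π * τ) ^ (-(n : ℝ) / 2)) *
        Real.exp (-‖w‖ ^ 2 / (2 * s) + -‖u - a • w‖ ^ 2 / (2 * τ)) := by
        rw [Real.exp_add]; ring
    _ = _ := by rw [hc, he, Real.exp_add]; ring

theorem gk_conv (n : ℕ) {s τ a : ℝ} (hs : 0 < s) (hτ : 0 < τ)
    (x z : EuclideanSpace ℝ (Fin n)) :
    Integrable (fun y => gaussKernel n s (y - z) * gaussKernel n τ (x - a • y)) ∧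
    ∫ y, gaussKernel n s (y - z) * gaussKernel n τ (x - a • y) =
      gaussKernel n (a ^ 2 * s + τ) (x - a • z) := by
  have hr : 0 < s * τ / (a ^ 2 * s + τ) := by positivity
  simp_rw [gk_mul n hs hτ]
  constructor
  · exact ((gk_integrable n hr).comp_sub_right _).const_mul _
  · rw [integral_const_mul, integral_sub_right_eq_self (fun y => gaussKernel n _ y),
      gk_integral n hr, mul_one]

/-- mixtures -/
noncomputable def mixQ (n : ℕ) (μ : Measure (EuclideanSpace ℝ (Fin n))) (s a : ℝ)
    (x : EuclideanSpace ℝ (Fin n)) : ℝ := ∫ y, gaussKernel n s (x - a • y) ∂μ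

theorem mix_conv (n : ℕ) (μ : Measure (EuclideanSpace ℝ (Fin n))) [IsProbabilityMeasure μ]
    {s τ a : ℝ} (hs : 0 < s) (hτ : 0 < τ) (x : EuclideanSpace ℝ (Fin n)) :
    ∫ y, mixQ n μ s 1 y * gaussKernel n τ (x - a • y) = mixQ n μ (a ^ 2 * s + τ) a x := by
  unfold mixQ
  simp_rw [← integral_mul_const, one_smul]
  have hr : 0 < a ^ 2 * s + τ := by positivity
  rw [integral_integral_swap]
  · simp_rw [(gk_conv n hs hτ x _).2]
  · have hc : Continuous (Function.uncurry fun (y z : EuclideanSpace ℝ (Fin n)) =>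
        gaussKernel n s (y - z) * gaussKernel n τ (x - a • y)) := by
      have := gk_cont n s
      have := gk_cont n τ
      unfold Function.uncurry
      fun_prop
    rw [integrable_prod_iff' hc.aestronglyMeasurable]
    constructor
    · exact Eventually.of_forall fun z => (gk_conv n hs hτ x z).1
    · have : ∀ z y, ‖Function.uncurry (fun (y z : EuclideanSpace ℝ (Fin n)) =>
        gaussKernel n s (y - z) * gaussKernel n τ (x - a • y)) (y, z)‖ =
          gaussKernel n s (y - z) * gaussKernel n τ (x - a • y) := by
        intro z y
        simp only [Function.uncurry]
        rw [Real.norm_of_nonneg]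
        exact (mul_pos (gk_pos n hs _) (gk_pos n hτ _)).le
      simp_rw [this, (gk_conv n hs hτ x _).2]
      refine Integrable.of_bound (C := (2 * π * (a ^ 2 * s + τ)) ^ (-(n : ℝ) / 2)) ?_ ?_
      · have := gk_cont n (a ^ 2 * s + τ)
        exact Continuous.aestronglyMeasurable (by fun_prop)
      · refine Eventually.of_forall fun z => ?_
        rw [Real.norm_of_nonneg (gk_pos n hr _).le]
        exact gk_le n hr _

theorem gk_int_mu (n : ℕ) (μ : Measure (EuclideanSpace ℝ (Fin n))) [IsFiniteMeasure μ]
    {s : ℝ} (a : ℝ) (hs : 0 < s) (x : EuclideanSpace ℝ (Fin n)) :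
    Integrable (fun y => gaussKernel n s (x - a • y)) μ := by
  refine Integrable.of_bound (C := (2 * π * s) ^ (-(n : ℝ) / 2)) ?_ ?_
  · have := gk_cont n s
    exact Continuous.aestronglyMeasurable (by fun_prop)
  · refine Eventually.of_forall fun z => ?_
    rw [Real.norm_of_nonneg (gk_pos n hs _).le]
    exact gk_le n hs _

theorem mix_integrable (n : ℕ) (μ : Measure (EuclideanSpace ℝ (Fin n))) [IsProbabilityMeasure μ]
    {s a : ℝ} (hs : 0 < s) : Integrable (mixQ n μ s a) ∧ ∫ x, mixQ n μ s a x = 1 := by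
  have hc : Continuous (Function.uncurry fun (x y : EuclideanSpace ℝ (Fin n)) =>
        gaussKernel n s (x - a • y)) := by
      have := gk_cont n s
      unfold Function.uncurry
      fun_prop
  have hi : Integrable (Function.uncurry fun (x y : EuclideanSpace ℝ (Fin n)) =>
        gaussKernel n s (x - a • y)) (volume.prod μ) := by
    rw [integrable_prod_iff' hc.aestronglyMeasurable]
    constructor
    · exact Eventually.of_forall fun z => (gk_integrable n hs).comp_sub_right (a • z)
    · have : ∀ z y, ‖Function.uncurry (fun (x y : EuclideanSpace ℝ (Fin n)) =>
        gaussKernel n s (x - a • y)) (y, z)‖ = gaussKernel n s (y - a • z) := by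
        intro z y
        simp only [Function.uncurry]
        rw [Real.norm_of_nonneg (gk_pos n hs _).le]
      simp_rw [this]
      simp_rw [integral_sub_right_eq_self (fun y => gaussKernel n s y), gk_integral n hs]
      exact integrable_const _
  constructor
  · exact hi.integral_prod_left
  · unfold mixQ
    rw [integral_integral_swap hi]
    simp_rw [integral_sub_right_eq_self (fun y => gaussKernel n s y), gk_integral n hs]
    simp

theorem vp_mix (n : ℕ) (μ : Measure (EuclideanSpace ℝ (Fin n))) [IsProbabilityMeasure μ]
    {s t : ℝ} (hs : 0 < s) (ht : 0 ≤ t) (x : EuclideanSpace ℝ (Fin n)) :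
    vpMarginal n (mixQ n μ s 1) t x =
      mixQ n μ (Real.exp (-t) * s + (1 - Real.exp (-t))) (Real.exp (-t / 2)) x := by
  unfold vpMarginal
  split_ifs with h
  · subst h; simp
  · have ht' : 0 < t := lt_of_le_of_ne ht (Ne.symm h)
    have : 0 < 1 - Real.exp (-t) := by
      have : Real.exp (-t) < 1 := by rw [Real.exp_lt_one_iff]; linarith
      linarith
    rw [mix_conv n μ hs this]
    congr 2
    rw [← Real.exp_nat_mul]
    congr 2; push_cast; ring

theorem gaussMat_smul (n : ℕ) {s : ℝ} (hs : 0 < s) (z : EuclideanSpace ℝ (Fin n)) :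
    gaussMat n (s • (1 : Matrix (Fin n) (Fin n) ℝ)) z = gaussKernel n s z := by
  unfold gaussMat gaussKernel
  have hi : (s • (1 : Matrix (Fin n) (Fin n) ℝ))⁻¹ = s⁻¹ • 1 := by
    apply Matrix.inv_eq_right_inv
    simp [smul_smul, hs.ne']
  rw [hi]
  congr 1
  · rw [Matrix.det_smul, Matrix.det_one, mul_one, Fintype.card_fin, ← mul_pow,
      ← Real.rpow_natCast, ← Real.rpow_mul (by positivity)]
    congr 1; ring
  · congr 1
    rw [EuclideanSpace.real_norm_sq_eq]
    simp only [Matrix.smul_mulVec, Matrix.one_mulVec, Pi.smul_apply, smul_eq_mul]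
    rw [show ∑ i, z i * (s⁻¹ * z i) = s⁻¹ * ∑ i, z i ^ 2 by
      rw [Finset.mul_sum]; exact Finset.sum_congr rfl fun i _ => by ring]
    field_simp

theorem integral_pos' {α : Type*} [MeasurableSpace α] (μ : Measure α) [IsProbabilityMeasure μ]
    {f : α → ℝ} (hf : ∀ x, 0 < f x) (hi : Integrable f μ) : 0 < ∫ x, f x ∂μ := by
  rw [integral_pos_iff_support_of_nonneg (fun x => (hf x).le) hi]
  have : Function.support f = univ := by
    ext x; simp [(hf x).ne']
  rw [this]; simp

theorem expo_norm_le {n : ℕ} {F : Type*} [NormedAddCommGroup F]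
    [NormedSpace ℝ F] {b R : ℝ} (hb : 0 ≤ b)
    (h : EuclideanSpace ℝ (Fin n) → F) (x y : EuclideanSpace ℝ (Fin n)) (hy : ‖y‖ ≤ R) :
    ‖Real.exp ⟪x, b • y⟫ • (innerSL ℝ (b • y)).smulRight (h y)‖ ≤
      (b * R) * (Real.exp ⟪x, b • y⟫ * ‖h y‖) := by
  rw [norm_smul, ContinuousLinearMap.norm_smulRight_apply, innerSL_apply_norm, norm_smul,
    Real.norm_of_nonneg hb, Real.norm_of_nonneg (Real.exp_pos _).le]
  have : b * ‖y‖ ≤ b * R := mul_le_mul_of_nonneg_left hy hb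
  calc _ = (b * ‖y‖) * (Real.exp ⟪x, b • y⟫ * ‖h y‖) := by ring
    _ ≤ _ := by gcongr

theorem expo_le {n : ℕ} {b R : ℝ} (hb : 0 ≤ b) (x y : EuclideanSpace ℝ (Fin n)) (hy : ‖y‖ ≤ R) :
    Real.exp ⟪x, b • y⟫ ≤ Real.exp (‖x‖ * (b * R)) := by
  apply Real.exp_le_exp.2
  refine (real_inner_le_norm _ _).trans ?_
  rw [norm_smul, Real.norm_of_nonneg hb]
  gcongr

theorem expo_integrable {n : ℕ} {F : Type*} [NormedAddCommGroup F]
    [NormedSpace ℝ F] (ν : Measure (EuclideanSpace ℝ (Fin n)))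
    [IsFiniteMeasure ν] {b R C : ℝ} (hb : 0 ≤ b) (hR : ∀ᵐ y ∂ν, ‖y‖ ≤ R)
    (h : EuclideanSpace ℝ (Fin n) → F) (hc : Continuous h) (hC : ∀ᵐ y ∂ν, ‖h y‖ ≤ C)
    (x : EuclideanSpace ℝ (Fin n)) :
    Integrable (fun y => Real.exp ⟪x, b • y⟫ • h y) ν := by
  refine Integrable.of_bound (C := Real.exp (‖x‖ * (b * R)) * C) ?_ ?_
  · exact Continuous.aestronglyMeasurable (by fun_prop)
  · filter_upwards [hR, hC] with y hy hyC
    rw [norm_smul, Real.norm_of_nonneg (Real.exp_pos _).le]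
    exact mul_le_mul (expo_le hb x y hy) hyC (norm_nonneg _) (Real.exp_pos _).le

theorem smulRight_cont {n : ℕ} {F : Type*} [NormedAddCommGroup F]
    [NormedSpace ℝ F] (b : ℝ) (h : EuclideanSpace ℝ (Fin n) → F) (hc : Continuous h) :
    Continuous fun y => (innerSL ℝ (b • y)).smulRight (h y) := by
  have : (fun y => (innerSL ℝ (b • y)).smulRight (h y)) = fun y =>
      ContinuousLinearMap.smulRightL ℝ (EuclideanSpace ℝ (Fin n)) F (innerSL ℝ (b • y)) (h y) := by
    ext y; rfl
  rw [this]
  fun_prop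

theorem expo_hasFDerivAt {n : ℕ} {F : Type*} [NormedAddCommGroup F]
    [NormedSpace ℝ F] (ν : Measure (EuclideanSpace ℝ (Fin n)))
    [IsFiniteMeasure ν] {b R C : ℝ} (hb : 0 ≤ b) (hR : ∀ᵐ y ∂ν, ‖y‖ ≤ R)
    (h : EuclideanSpace ℝ (Fin n) → F) (hc : Continuous h) (hC : ∀ᵐ y ∂ν, ‖h y‖ ≤ C)
    (x : EuclideanSpace ℝ (Fin n)) :
    HasFDerivAt (fun x => ∫ y, Real.exp ⟪x, b • y⟫ • h y ∂ν)
      (∫ y, Real.exp ⟪x, b • y⟫ • (innerSL ℝ (b • y)).smulRight (h y) ∂ν) x := by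
  refine hasFDerivAt_integral_of_dominated_of_fderiv_le
    (F := fun x y => Real.exp ⟪x, b • y⟫ • h y)
    (F' := fun x y => Real.exp ⟪x, b • y⟫ • (innerSL ℝ (b • y)).smulRight (h y))
    (bound := fun _ => (b * R) * (Real.exp ((‖x‖ + 1) * (b * R)) * C))
    (Metric.ball_mem_nhds x one_pos) ?_ ?_ ?_ ?_ ?_ ?_
  · exact Eventually.of_forall fun z => Continuous.aestronglyMeasurable (by fun_prop)
  · exact expo_integrable ν hb hR h hc hC x
  · have := smulRight_cont b h hc
    exact Continuous.aestronglyMeasurable (by fun_prop)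
  · filter_upwards [hR, hC] with y hy hyC z hz
    have hR0 : 0 ≤ R := (norm_nonneg _).trans hy
    refine (expo_norm_le hb h z y hy).trans ?_
    have hz' : ‖z‖ ≤ ‖x‖ + 1 := by
      have := norm_sub_norm_le z x
      rw [mem_ball_iff_norm] at hz
      linarith
    have h3 : Real.exp ⟪z, b • y⟫ ≤ Real.exp ((‖x‖ + 1) * (b * R)) := by
      refine (expo_le hb z y hy).trans ?_
      gcongr
    exact mul_le_mul_of_nonneg_left (mul_le_mul h3 hyC (norm_nonneg _) (Real.exp_pos _).le)
      (by positivity)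
  · exact integrable_const _
  · refine Eventually.of_forall fun y z _ => ?_
    have h1 : HasFDerivAt (fun z : EuclideanSpace ℝ (Fin n) => ⟪z, b • y⟫) (innerSL ℝ (b • y)) z := by
      have := (innerSL ℝ (b • y)).hasFDerivAt (x := z)
      refine this.congr_of_eventuallyEq (Eventually.of_forall fun w => ?_)
      rw [innerSL_apply_apply, real_inner_comm]
    have h2 := (h1.exp).smul_const (h y)
    convert h2 using 1
    ext w
    simp [mul_smul]

set_option maxSynthPendingDepth 3 in
theorem hess_log {E : Type*} [NormedAddCommGroup E] [InnerProductSpace ℝ E] {c s B : ℝ}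
    (hc : 0 < c) (hB : 0 ≤ B)
    (G : E → ℝ) (G1 : E → E →L[ℝ] ℝ) (G2 : E → E →L[ℝ] E →L[ℝ] ℝ) (hG : ∀ x, 0 < G x)
    (h1 : ∀ x, HasFDerivAt G (G1 x) x) (h2 : ∀ x, HasFDerivAt G1 (G2 x) x)
    (b1 : ∀ x, ‖G1 x‖ ≤ B * G x) (b2 : ∀ x, ‖G2 x‖ ≤ B ^ 2 * G x) (hs : 0 < s) :
    TwiceDiff (fun x => Real.log (c * Real.exp (-‖x‖ ^ 2 / (2 * s)) * G x)) ∧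
    ∀ x, ‖hessian (fun x => Real.log (c * Real.exp (-‖x‖ ^ 2 / (2 * s)) * G x)) x‖ ≤
      1 / s + 2 * B ^ 2 := by
  have e : (fun x => Real.log (c * Real.exp (-‖x‖ ^ 2 / (2 * s)) * G x)) =
      fun x => (Real.log c + (-(2 * s)⁻¹) * ‖x‖ ^ 2) + Real.log (G x) := by
    ext x
    rw [Real.log_mul (by positivity) (hG x).ne', Real.log_mul hc.ne' (by positivity),
      Real.log_exp]
    congr 2
    field_simp
  rw [e]
  obtain ⟨iS, hiS⟩ : ∃ L : E →L[ℝ] E →L[ℝ] ℝ, ∀ x, L x = innerSL ℝ x :=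
    ⟨innerSL ℝ, fun _ => rfl⟩
  have d1 : ∀ x, HasFDerivAt (fun x => (Real.log c + (-(2 * s)⁻¹) * ‖x‖ ^ 2) + Real.log (G x))
      ((-(1 / s)) • iS x + (G x)⁻¹ • G1 x) x := by
    intro x
    have a1 := ((hasStrictFDerivAt_norm_sq x).hasFDerivAt.const_mul (-(2 * s)⁻¹)).const_add
      (Real.log c)
    refine HasFDerivAt.add ?_ ((h1 x).log (hG x).ne')
    convert a1 using 1
    rw [hiS, ← Nat.cast_smul_eq_nsmul ℝ, smul_smul]
    congr 1
    push_cast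
    field_simp
  have f1 : fderiv ℝ (fun x => (Real.log c + (-(2 * s)⁻¹) * ‖x‖ ^ 2) + Real.log (G x)) =
      fun x => (-(1 / s)) • iS x + (G x)⁻¹ • G1 x := by
    ext1 x; exact (d1 x).fderiv
  have d2 : ∀ x, HasFDerivAt (fun x => (-(1 / s)) • iS x + (G x)⁻¹ • G1 x)
      ((-(1 / s)) • iS + ((G x)⁻¹ • G2 x + (-(G x ^ 2)⁻¹ • G1 x).smulRight (G1 x))) x := by
    intro x
    refine HasFDerivAt.add ?_ ?_
    · exact (iS.hasFDerivAt).const_smul (-(1 / s))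
    · have := (hasDerivAt_inv (hG x).ne').comp_hasFDerivAt x (h1 x)
      exact this.smul (h2 x)
  refine ⟨⟨fun x => (d1 x).differentiableAt, ?_⟩, ?_⟩
  · rw [f1]; exact fun x => (d2 x).differentiableAt
  · intro x
    unfold hessian
    rw [f1, (d2 x).fderiv]
    have hGx := hG x
    have n1 : ‖(-(1 / s)) • iS‖ ≤ 1 / s := by
      rw [norm_smul, norm_neg, Real.norm_of_nonneg (by positivity)]
      have : ‖iS‖ ≤ 1 := by
        refine ContinuousLinearMap.opNorm_le_bound _ zero_le_one fun y => ?_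
        rw [hiS, innerSL_apply_norm, one_mul]
      have h' : 0 < 1 / s := by positivity
      nlinarith
    have n2 : ‖(G x)⁻¹ • G2 x‖ ≤ B ^ 2 := by
      rw [norm_smul, norm_inv, Real.norm_of_nonneg hGx.le, inv_mul_le_iff₀ hGx, mul_comm]
      exact b2 x
    have n3 : ‖(-(G x ^ 2)⁻¹ • G1 x).smulRight (G1 x)‖ ≤ B ^ 2 := by
      rw [ContinuousLinearMap.norm_smulRight_apply, norm_smul, norm_neg, norm_inv,
        Real.norm_of_nonneg (by positivity), mul_assoc, inv_mul_le_iff₀ (by positivity)]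
      calc ‖G1 x‖ * ‖G1 x‖ ≤ (B * G x) * (B * G x) := by
            gcongr <;> exact b1 x
        _ = _ := by ring
    calc ‖(-(1 / s)) • iS + ((G x)⁻¹ • G2 x + (-(G x ^ 2)⁻¹ • G1 x).smulRight (G1 x))‖ ≤ ‖(-(1 / s)) • iS‖ + (‖(G x)⁻¹ • G2 x‖ +
          ‖(-(G x ^ 2)⁻¹ • G1 x).smulRight (G1 x)‖) :=
          (norm_add_le _ _).trans (add_le_add le_rfl (norm_add_le _ _))
      _ ≤ 1 / s + 2 * B ^ 2 := by linarith

theorem mix_pos (n : ℕ) (μ : Measure (EuclideanSpace ℝ (Fin n))) [IsProbabilityMeasure μ]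
    {s a : ℝ} (hs : 0 < s) (x : EuclideanSpace ℝ (Fin n)) : 0 < mixQ n μ s a x :=
  integral_pos' μ (fun _ => gk_pos n hs _) (gk_int_mu n μ a hs x)

theorem mix_hess (n : ℕ) (μ : Measure (EuclideanSpace ℝ (Fin n))) [IsProbabilityMeasure μ]
    {s a m R : ℝ} (hm : 0 < m) (hms : m ≤ s) (ha : 0 ≤ a) (ha1 : a ≤ 1) (hR0 : 0 ≤ R)
    (hR : ∀ᵐ y ∂μ, ‖y‖ ≤ R) :
    TwiceDiff (fun x => Real.log (mixQ n μ s a x)) ∧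
    ∀ x, ‖hessian (fun x => Real.log (mixQ n μ s a x)) x‖ ≤ 1 / m + 2 * (R / m) ^ 2 := by
  have hs : 0 < s := hm.trans_le hms
  set b := a / s with hb
  have hb0 : 0 ≤ b := by positivity
  set h0 : EuclideanSpace ℝ (Fin n) → ℝ := fun y => Real.exp (-(a ^ 2 * ‖y‖ ^ 2) / (2 * s)) with hh0
  have h0pos : ∀ y, 0 < h0 y := fun y => Real.exp_pos _
  have h0c : Continuous h0 := by fun_prop
  have h0b : ∀ᵐ y ∂μ, ‖h0 y‖ ≤ 1 := by
    refine Eventually.of_forall fun y => ?_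
    rw [Real.norm_of_nonneg (h0pos y).le, Real.exp_le_one_iff]
    apply div_nonpos_of_nonpos_of_nonneg
    · nlinarith [sq_nonneg (a * ‖y‖)]
    · positivity
  set h1 : EuclideanSpace ℝ (Fin n) → EuclideanSpace ℝ (Fin n) →L[ℝ] ℝ := fun y =>
    (innerSL ℝ (b • y)).smulRight (h0 y) with hh1
  have h1c : Continuous h1 := smulRight_cont b h0 h0c
  have h1n : ∀ y, ‖y‖ ≤ R → ‖h1 y‖ ≤ (b * R) * h0 y := by
    intro y hy
    rw [hh1, ContinuousLinearMap.norm_smulRight_apply, innerSL_apply_norm, norm_smul,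
      Real.norm_of_nonneg hb0, Real.norm_of_nonneg (h0pos y).le]
    have := h0pos y
    gcongr
  have h1b : ∀ᵐ y ∂μ, ‖h1 y‖ ≤ b * R := by
    filter_upwards [hR, h0b] with y hy hy0
    rw [Real.norm_of_nonneg (h0pos y).le] at hy0
    refine (h1n y hy).trans ?_
    have : 0 ≤ b * R := by positivity
    nlinarith
  set G : EuclideanSpace ℝ (Fin n) → ℝ := fun x => ∫ y, Real.exp ⟪x, b • y⟫ • h0 y ∂μ with hGd
  set G1 : EuclideanSpace ℝ (Fin n) → EuclideanSpace ℝ (Fin n) →L[ℝ] ℝ :=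
    fun x => ∫ y, Real.exp ⟪x, b • y⟫ • h1 y ∂μ with hG1
  set G2 : EuclideanSpace ℝ (Fin n) → EuclideanSpace ℝ (Fin n) →L[ℝ] EuclideanSpace ℝ (Fin n) →L[ℝ] ℝ :=
    fun x => ∫ y, Real.exp ⟪x, b • y⟫ • (innerSL ℝ (b • y)).smulRight (h1 y) ∂μ with hG2
  have hGi : ∀ x, Integrable (fun y => Real.exp ⟪x, b • y⟫ • h0 y) μ :=
    fun x => expo_integrable μ hb0 hR h0 h0c h0b x
  have key := hess_log (c := (2 * π * s) ^ (-(n : ℝ) / 2)) (s := s) (B := b * R)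
    (by positivity) (by positivity) G G1 G2
    (fun x => integral_pos' μ (fun y => by have := h0pos y; positivity) (hGi x))
    (fun x => expo_hasFDerivAt μ hb0 hR h0 h0c h0b x)
    (fun x => expo_hasFDerivAt μ hb0 hR h1 h1c h1b x)
    (by
      intro x
      rw [hG1, hGd]
      simp only
      rw [← integral_const_mul]
      refine norm_integral_le_of_norm_le ((hGi x).const_mul _) ?_
      filter_upwards [hR] with y hy
      refine (expo_norm_le hb0 h0 x y hy).trans (le_of_eq ?_)
      rw [Real.norm_of_nonneg (h0pos y).le, smul_eq_mul])
    (by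
      intro x
      rw [hG2, hGd]
      simp only
      rw [← integral_const_mul]
      refine norm_integral_le_of_norm_le ((hGi x).const_mul _) ?_
      filter_upwards [hR] with y hy
      refine (expo_norm_le hb0 h1 x y hy).trans ?_
      rw [smul_eq_mul]
      calc _ ≤ b * R * (Real.exp ⟪x, b • y⟫ * ((b * R) * h0 y)) := by
            gcongr; exact h1n y hy
        _ = _ := by ring)
    hs
  have eq : (fun x => Real.log (mixQ n μ s a x)) = fun x =>
      Real.log ((2 * π * s) ^ (-(n : ℝ) / 2) * Real.exp (-‖x‖ ^ 2 / (2 * s)) * G x) := by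
    ext x
    congr 1
    unfold mixQ gaussKernel
    rw [hGd]
    simp only
    rw [← integral_const_mul]
    congr 1
    ext y
    rw [smul_eq_mul, mul_assoc (_ ^ _), ← Real.exp_add, ← Real.exp_add]
    congr 2
    rw [norm_sub_sq_real, norm_smul, mul_pow, inner_smul_right, inner_smul_right,
      Real.norm_eq_abs, sq_abs, hb]
    field_simp
    ring
  rw [eq]
  refine ⟨key.1, fun x => (key.2 x).trans ?_⟩
  have hbR : b * R ≤ R / m := by
    rw [hb, div_mul_eq_mul_div]
    gcongr
    nlinarith
  gcongr

theorem vField_lip (n : ℕ) (p : EuclideanSpace ℝ (Fin n) → ℝ) (t : ℝ) (M : NNReal)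
    (h : TwiceDiff (fun x => Real.log (vpMarginal n p t x)))
    (hM : ∀ x, ‖hessian (fun x => Real.log (vpMarginal n p t x)) x‖ ≤ M) :
    LipschitzWith (1 + M) (vField n p t) := by
  have h1 : LipschitzWith M (fderiv ℝ (fun x => Real.log (vpMarginal n p t x))) :=
    lipschitzWith_of_nnnorm_fderiv_le h.2 (fun x => hM x)
  refine LipschitzWith.of_dist_le_mul fun x y => ?_
  have h2 := h1.dist_le_mul x y
  have h3 : dist (score n p t x) (score n p t y) ≤ M * dist x y := by
    unfold score gradient
    rwa [LinearIsometryEquiv.dist_map]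
  rw [dist_eq_norm] at h3 ⊢
  unfold vField
  calc _ = ‖-(2 : ℝ)⁻¹ • (x - y) - (2 : ℝ)⁻¹ • (score n p t x - score n p t y)‖ := by
        congr 1; module
    _ ≤ ‖-(2 : ℝ)⁻¹ • (x - y)‖ + ‖(2 : ℝ)⁻¹ • (score n p t x - score n p t y)‖ := norm_sub_le _ _
    _ = 2⁻¹ * dist x y + 2⁻¹ * ‖score n p t x - score n p t y‖ := by
        rw [norm_smul, norm_smul, dist_eq_norm]; norm_num
    _ ≤ _ := by
        push_cast
        have := dist_nonneg (x := x) (y := y)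
        have := M.2
        nlinarith [norm_nonneg (score n p t x - score n p t y)]

theorem flow_bilip (n : ℕ) (v : ℝ → EuclideanSpace ℝ (Fin n) → EuclideanSpace ℝ (Fin n)) {T : ℝ}
    (hT : 0 < T) (K : NNReal) (hv : ∀ t ∈ Icc 0 T, LipschitzWith K (v t))
    (φ : EuclideanSpace ℝ (Fin n) → EuclideanSpace ℝ (Fin n)) (hφ : IsFlowMap n v 0 T φ) :
    BiLipschitz φ := by
  refine ⟨Real.exp (-(K * T)), Real.exp (K * T), Real.exp_pos _, ?_, fun x y => ?_⟩
  · apply Real.exp_le_exp.2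
    have : 0 ≤ (K : ℝ) * T := by positivity
    linarith
  obtain ⟨f, f0, hf, fT⟩ := hφ x
  obtain ⟨g, g0, hg, gT⟩ := hφ y
  have up := dist_le_of_trajectories_ODE_of_mem (v := v) (K := K) (s := fun _ => univ)
    (f := f) (g := g) (a := 0) (b := T) (δ := dist x y)
    (fun t ht => (hv t (Ico_subset_Icc_self ht)).lipschitzOnWith)
    (fun t ht => (hf t ht).continuousAt.continuousWithinAt)
    (fun t ht => (hf t (Ico_subset_Icc_self ht)).hasDerivWithinAt) (fun _ _ => trivial)
    (fun t ht => (hg t ht).continuousAt.continuousWithinAt)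
    (fun t ht => (hg t (Ico_subset_Icc_self ht)).hasDerivWithinAt) (fun _ _ => trivial)
    (by rw [f0, g0]) T ⟨hT.le, le_rfl⟩
  have mem : ∀ t ∈ Icc 0 T, T - t ∈ Icc 0 T := fun t ht => ⟨by linarith [ht.2], by linarith [ht.1]⟩
  have rev : ∀ f : ℝ → EuclideanSpace ℝ (Fin n), (∀ t ∈ Icc 0 T, HasDerivAt f (v t (f t)) t) →
      ∀ t ∈ Icc 0 T, HasDerivAt (fun t => f (T - t)) (-(v (T - t) (f (T - t)))) t := by
    intro f hf t ht
    have := (hf (T - t) (mem t ht)).scomp t ((hasDerivAt_id t).const_sub T)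
    have e : (-1 : ℝ) • v (T - t) (f (T - t)) = -(v (T - t) (f (T - t))) := by simp
    rw [← e]
    exact this
  have down := dist_le_of_trajectories_ODE_of_mem (v := fun t z => -(v (T - t) z)) (K := K)
    (s := fun _ => univ)
    (f := fun t => f (T - t)) (g := fun t => g (T - t)) (a := 0) (b := T) (δ := dist (φ x) (φ y))
    (fun t ht => (hv _ (mem t (Ico_subset_Icc_self ht))).neg.lipschitzOnWith)
    (fun t ht => (rev f hf t ht).continuousAt.continuousWithinAt)
    (fun t ht => (rev f hf t (Ico_subset_Icc_self ht)).hasDerivWithinAt) (fun _ _ => trivial)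
    (fun t ht => (rev g hg t ht).continuousAt.continuousWithinAt)
    (fun t ht => (rev g hg t (Ico_subset_Icc_self ht)).hasDerivWithinAt) (fun _ _ => trivial)
    (by simp [fT, gT]) T ⟨hT.le, le_rfl⟩
  simp only [sub_self, sub_zero, f0, g0, fT, gT] at up down
  rw [dist_eq_norm, dist_eq_norm] at up down
  constructor
  · rw [Real.exp_neg, inv_mul_le_iff₀ (Real.exp_pos _), mul_comm]
    exact down
  · rw [mul_comm]; exact up

theorem scheffe {α ι : Type*} [MeasurableSpace α] (μ : Measure α) {l : Filter ι}
    [l.IsCountablyGenerated] {F : ι → α → ℝ} {f : α → ℝ}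
    (hF : ∀ᶠ k in l, Integrable (F k) μ ∧ (∀ x, 0 ≤ F k x) ∧ ∫ x, F k x ∂μ = 1)
    (hf : Integrable f μ) (hf0 : ∀ x, 0 ≤ f x) (hf1 : ∫ x, f x ∂μ = 1)
    (hlim : ∀ x, Tendsto (fun k => F k x) l (𝓝 (f x))) :
    Tendsto (fun k => ∫ x, |F k x - f x| ∂μ) l (𝓝 0) := by
  have h1 : Tendsto (fun k => ∫ x, max (f x - F k x) 0 ∂μ) l (𝓝 (∫ x, (0 : ℝ) ∂μ)) := by
    refine tendsto_integral_filter_of_dominated_convergence f ?_ ?_ hf ?_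
    · filter_upwards [hF] with k hk
      exact ((hf.sub hk.1).pos_part).aestronglyMeasurable
    · filter_upwards [hF] with k hk
      refine Eventually.of_forall fun x => ?_
      rw [Real.norm_of_nonneg (le_max_right _ _)]
      exact max_le (by linarith [hk.2.1 x]) (hf0 x)
    · refine Eventually.of_forall fun x => ?_
      have : Tendsto (fun k => max (f x - F k x) 0) l (𝓝 (max (f x - f x) 0)) :=
        (tendsto_const_nhds.sub (hlim x)).max tendsto_const_nhds
      simpa using this
  rw [integral_zero] at h1
  have h2 := h1.const_mul 2
  rw [mul_zero] at h2
  refine h2.congr' ?_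
  filter_upwards [hF] with k hk
  have e : ∀ x, |F k x - f x| = 2 * max (f x - F k x) 0 - (f x - F k x) := by
    intro x
    rcases le_total (F k x) (f x) with h | h
    · rw [abs_of_nonpos (by linarith), max_eq_left (by linarith)]; ring
    · rw [abs_of_nonneg (by linarith), max_eq_right (by linarith)]; ring
  simp_rw [e]
  have i1 : Integrable (fun x => f x - F k x) μ := hf.sub hk.1
  have i2 : Integrable (fun x => 2 * max (f x - F k x) 0) μ := i1.pos_part.const_mul 2
  rw [integral_sub i2 i1, integral_const_mul,
    integral_sub hf hk.1, hf1, hk.2.2]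
  simp

theorem tv_tri {α : Type*} [MeasurableSpace α] (μ ν ρ : Measure α) :
    tvDist μ ρ ≤ tvDist μ ν + tvDist ν ρ := by
  unfold tvDist
  rw [add_add_add_comm]
  refine add_le_add ?_ ?_
  · refine iSup₂_le fun s hs => (tsub_le_tsub_add_tsub (b := ν s)).trans (add_le_add ?_ ?_)
    · exact le_iSup₂ (f := fun (s : Set α) (_ : MeasurableSet s) => μ s - ν s) s hs
    · exact le_iSup₂ (f := fun (s : Set α) (_ : MeasurableSet s) => ν s - ρ s) s hs
  · rw [add_comm]
    refine iSup₂_le fun s hs => (tsub_le_tsub_add_tsub (b := ν s)).trans (add_le_add ?_ ?_)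
    · exact le_iSup₂ (f := fun (s : Set α) (_ : MeasurableSet s) => ρ s - ν s) s hs
    · exact le_iSup₂ (f := fun (s : Set α) (_ : MeasurableSet s) => ν s - μ s) s hs

theorem tv_map {α : Type*} [MeasurableSpace α] (μ ν : Measure α) (f : α → α) (hf : Measurable f) :
    tvDist (μ.map f) (ν.map f) ≤ tvDist μ ν := by
  unfold tvDist
  refine add_le_add ?_ ?_
  · refine iSup₂_le fun s hs => ?_
    rw [Measure.map_apply hf hs, Measure.map_apply hf hs]
    exact le_iSup₂ (f := fun (s : Set α) (_ : MeasurableSet s) => μ s - ν s) _ (hf hs)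
  · refine iSup₂_le fun s hs => ?_
    rw [Measure.map_apply hf hs, Measure.map_apply hf hs]
    exact le_iSup₂ (f := fun (s : Set α) (_ : MeasurableSet s) => ν s - μ s) _ (hf hs)

theorem dens_sub (n : ℕ) {f g : EuclideanSpace ℝ (Fin n) → ℝ} (hf : Integrable f)
    (hg : Integrable g) (s : Set (EuclideanSpace ℝ (Fin n))) (hs : MeasurableSet s) :
    densMeasure n f s - densMeasure n g s ≤ ENNReal.ofReal (∫ x, |f x - g x|) := by
  have hfg : Integrable (fun x => |f x - g x|) := (hf.sub hg).abs
  rw [tsub_le_iff_left]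
  unfold densMeasure
  rw [withDensity_apply _ hs, withDensity_apply _ hs,
    ofReal_integral_eq_lintegral_ofReal hfg (Eventually.of_forall fun x => abs_nonneg _)]
  calc ∫⁻ x in s, ENNReal.ofReal (f x)
      ≤ ∫⁻ x in s, (ENNReal.ofReal (g x) + ENNReal.ofReal |f x - g x|) := by
        refine lintegral_mono fun x => ?_
        refine le_trans (ENNReal.ofReal_le_ofReal ?_) ENNReal.ofReal_add_le
        linarith [le_abs_self (f x - g x)]
    _ = (∫⁻ x in s, ENNReal.ofReal (g x)) + ∫⁻ x in s, ENNReal.ofReal |f x - g x| := by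
        rw [lintegral_add_right' _ hfg.aestronglyMeasurable.aemeasurable.ennreal_ofReal.restrict]
    _ ≤ _ := by
        exact add_le_add le_rfl (setLIntegral_le_lintegral _ _)

theorem tv_dens (n : ℕ) {f g : EuclideanSpace ℝ (Fin n) → ℝ} (hf : Integrable f)
    (hg : Integrable g) :
    tvDist (densMeasure n f) (densMeasure n g) ≤ ENNReal.ofReal (2 * ∫ x, |f x - g x|) := by
  have h0 : 0 ≤ ∫ x, |f x - g x| := integral_nonneg fun x => abs_nonneg _
  rw [two_mul, ENNReal.ofReal_add h0 h0]
  unfold tvDist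
  refine add_le_add (iSup₂_le fun s hs => dens_sub n hf hg s hs)
    (iSup₂_le fun s hs => (dens_sub n hg hf s hs).trans (le_of_eq ?_))
  simp_rw [abs_sub_comm]

theorem exists_g (n : ℕ) (pH : EuclideanSpace ℝ (Fin n) → ℝ)
    (hnn : ∀ x, 0 ≤ pH x) (hint : Integrable pH) (hmass : ∫ x, pH x = 1) {δ : ℝ} (hδ : 0 < δ)
    (hδ1 : δ < 1) :
    ∃ g : EuclideanSpace ℝ (Fin n) → ℝ, Continuous g ∧ HasCompactSupport g ∧ (∀ x, 0 ≤ g x) ∧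
      Integrable g ∧ ∫ x, g x = 1 ∧ ∫ x, |pH x - g x| ≤ 2 * δ := by
  obtain ⟨g0, hs0, hb0, hc0, hi0⟩ := hint.exists_hasCompactSupport_integral_sub_le hδ
  set g1 : EuclideanSpace ℝ (Fin n) → ℝ := fun x => max (g0 x) 0 with hg1
  have hc1 : Continuous g1 := by fun_prop
  have hs1 : HasCompactSupport g1 := hs0.comp_left (g := fun u : ℝ => max u 0) (by simp)
  have hi1 : Integrable g1 := hi0.pos_part
  have hb1 : ∫ x, |pH x - g1 x| ≤ δ := by
    refine le_trans (integral_mono (hint.sub hi1).abs (hint.sub hi0).norm fun x => ?_) hb0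
    simp only [Pi.sub_apply, Real.norm_eq_abs, hg1]
    rcases le_total 0 (g0 x) with h | h
    · rw [max_eq_left h]
    · rw [max_eq_right h, sub_zero, abs_of_nonneg (hnn x)]
      rw [abs_of_nonneg (by linarith [hnn x])]; linarith
  set m := ∫ x, g1 x with hm
  have hm1 : |1 - m| ≤ δ := by
    rw [← hmass, hm, ← integral_sub hint hi1]
    exact (abs_integral_le_integral_abs).trans hb1
  have hm0 : 0 < m := by linarith [(abs_le.1 hm1).2]
  refine ⟨fun x => m⁻¹ * g1 x, by fun_prop, hs1.mul_left, fun x => ?_, hi1.const_mul _, ?_, ?_⟩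
  · have : 0 ≤ g1 x := le_max_right _ _
    positivity
  · rw [integral_const_mul, ← hm, inv_mul_cancel₀ hm0.ne']
  · have hx : ∀ x, |pH x - m⁻¹ * g1 x| ≤ |pH x - g1 x| + |1 - m⁻¹| * g1 x := by
      intro x
      have h0 : 0 ≤ g1 x := le_max_right _ _
      calc |pH x - m⁻¹ * g1 x| = |(pH x - g1 x) + (1 - m⁻¹) * g1 x| := by congr 1; ring
        _ ≤ _ := by
          refine (abs_add_le _ _).trans (le_of_eq ?_)
          rw [abs_mul, abs_of_nonneg h0]
    calc _ ≤ ∫ x, (|pH x - g1 x| + |1 - m⁻¹| * g1 x) :=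
          integral_mono (hint.sub (hi1.const_mul _)).abs
            ((hint.sub hi1).abs.add (hi1.const_mul _)) hx
      _ = (∫ x, |pH x - g1 x|) + |1 - m⁻¹| * m := by
          have i1 : Integrable (fun x => |pH x - g1 x|) := (hint.sub hi1).abs
          rw [integral_add i1 (hi1.const_mul _), integral_const_mul]
      _ = (∫ x, |pH x - g1 x|) + |1 - m| := by
          congr 1
          rw [← abs_of_pos hm0, ← abs_mul, abs_of_pos hm0, sub_mul, inv_mul_cancel₀ hm0.ne',
            abs_sub_comm, one_mul]
      _ ≤ _ := by linarith

theorem gk_scale (n : ℕ) {σ : ℝ} (hσ : 0 < σ) (u : EuclideanSpace ℝ (Fin n)) :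
    gaussKernel n (σ ^ 2) (σ • u) = (σ ^ n)⁻¹ * gaussKernel n 1 u := by
  unfold gaussKernel
  have h1 : (2 * π * σ ^ 2) ^ (-(n : ℝ) / 2) = (σ ^ n)⁻¹ * (2 * π * 1) ^ (-(n : ℝ) / 2) := by
    rw [mul_one, Real.mul_rpow (by positivity) (by positivity), mul_comm, ← Real.rpow_natCast σ 2,
      ← Real.rpow_mul hσ.le, ← Real.rpow_natCast σ n, ← Real.rpow_neg hσ.le]
    congr 2
    push_cast; ring
  rw [h1, norm_smul, Real.norm_of_nonneg hσ.le, mul_pow, mul_assoc]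
  congr 3
  field_simp

theorem mix_dens (n : ℕ) {g : EuclideanSpace ℝ (Fin n) → ℝ} (hg : Continuous g)
    (hg0 : ∀ x, 0 ≤ g x) {σ : ℝ} (hσ : 0 < σ) (x : EuclideanSpace ℝ (Fin n)) :
    mixQ n (densMeasure n g) (σ ^ 2) 1 x = ∫ u, gaussKernel n 1 u * g (x - σ • u) := by
  unfold mixQ densMeasure
  rw [integral_withDensity_eq_integral_toReal_smul (by fun_prop)
    (Eventually.of_forall fun x => ENNReal.ofReal_lt_top)]
  have e1 : ∀ y, (ENNReal.ofReal (g y)).toReal • gaussKernel n (σ ^ 2) (x - (1 : ℝ) • y) =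
      (fun w => gaussKernel n (σ ^ 2) w * g (x - w)) (x - y) := by
    intro y
    simp only [one_smul, ENNReal.toReal_ofReal (hg0 y), smul_eq_mul, sub_sub_cancel]
    ring
  simp_rw [e1]
  rw [integral_sub_left_eq_self (fun w => gaussKernel n (σ ^ 2) w * g (x - w)) volume x]
  have h := Measure.integral_comp_smul (volume : Measure (EuclideanSpace ℝ (Fin n)))
    (fun w => gaussKernel n (σ ^ 2) w * g (x - w)) σ
  simp only [gk_scale n hσ, finrank_euclideanSpace, Fintype.card_fin, mul_assoc, smul_eq_mul] at h
  rw [integral_const_mul, abs_of_pos (by positivity)] at h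
  exact (mul_left_cancel₀ (by positivity) h).symm

theorem lim_small (n : ℕ) {g : EuclideanSpace ℝ (Fin n) → ℝ} (hg : Continuous g)
    (hgs : HasCompactSupport g)
    (hg0 : ∀ x, 0 ≤ g x) (x : EuclideanSpace ℝ (Fin n)) :
    Tendsto (fun σ : ℝ => mixQ n (densMeasure n g) (σ ^ 2) 1 x) (𝓝[>] 0) (𝓝 (g x)) := by
  obtain ⟨C, hC⟩ := hg.bounded_above_of_compact_support hgs
  have h : Tendsto (fun σ : ℝ => ∫ u, gaussKernel n 1 u * g (x - σ • u)) (𝓝[>] 0)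
      (𝓝 (∫ u, gaussKernel n 1 u * g x)) := by
    have hk := gk_cont n 1
    refine tendsto_integral_filter_of_dominated_convergence (fun u => gaussKernel n 1 u * C)
      ?_ ?_ ((gk_integrable n one_pos).mul_const C) ?_
    · exact Eventually.of_forall fun σ => Continuous.aestronglyMeasurable (by fun_prop)
    · refine Eventually.of_forall fun σ => Eventually.of_forall fun u => ?_
      rw [norm_mul, Real.norm_of_nonneg (gk_pos n one_pos u).le]
      exact mul_le_mul_of_nonneg_left (hC _) (gk_pos n one_pos u).le
    · refine Eventually.of_forall fun u => ?_
      have : Continuous fun σ : ℝ => gaussKernel n 1 u * g (x - σ • u) := by fun_prop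
      have h2 := this.tendsto 0
      simp only [zero_smul, sub_zero] at h2
      exact h2.mono_left nhdsWithin_le_nhds
  rw [integral_mul_const, gk_integral n one_pos, one_mul] at h
  refine h.congr' ?_
  filter_upwards [self_mem_nhdsWithin] with σ hσ
  exact (mix_dens n hg hg0 hσ x).symm

theorem s_lower {s t : ℝ} (ht : 0 ≤ t) :
    min s 1 ≤ Real.exp (-t) * s + (1 - Real.exp (-t)) := by
  have h1 : Real.exp (-t) ≤ 1 := by rw [Real.exp_le_one_iff]; linarith
  have h0 := Real.exp_pos (-t)
  nlinarith [min_le_left s 1, min_le_right s 1]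

theorem lim_large (n : ℕ) (μ : Measure (EuclideanSpace ℝ (Fin n))) [IsProbabilityMeasure μ]
    {s : ℝ} (hs : 0 < s) (x : EuclideanSpace ℝ (Fin n)) :
    Tendsto (fun t : ℝ => mixQ n μ (Real.exp (-t) * s + (1 - Real.exp (-t))) (Real.exp (-t / 2)) x)
      atTop (𝓝 (gaussKernel n 1 x)) := by
  have hm : 0 < min s 1 := lt_min hs one_pos
  have h1 : Tendsto (fun t : ℝ => Real.exp (-t)) atTop (𝓝 0) :=
    Real.tendsto_exp_neg_atTop_nhds_zero
  have h2 : Tendsto (fun t : ℝ => Real.exp (-t / 2)) atTop (𝓝 0) := by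
    have := h1.comp (tendsto_id.atTop_div_const (two_pos : (0 : ℝ) < 2))
    refine this.congr fun t => ?_
    simp [neg_div]
  have h3 : Tendsto (fun t : ℝ => Real.exp (-t) * s + (1 - Real.exp (-t))) atTop (𝓝 1) := by
    have := (h1.mul_const s).add (h1.const_sub 1)
    simpa using this
  have h : Tendsto (fun t : ℝ => mixQ n μ (Real.exp (-t) * s + (1 - Real.exp (-t)))
      (Real.exp (-t / 2)) x) atTop (𝓝 (∫ y, gaussKernel n 1 x ∂μ)) := by
    unfold mixQ
    refine tendsto_integral_filter_of_dominated_convergence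
      (fun _ => (2 * π * min s 1) ^ (-(n : ℝ) / 2)) ?_ ?_ (integrable_const _) ?_
    · refine Eventually.of_forall fun t => Continuous.aestronglyMeasurable ?_
      have := gk_cont n (Real.exp (-t) * s + (1 - Real.exp (-t)))
      fun_prop
    · filter_upwards [eventually_ge_atTop 0] with t ht
      refine Eventually.of_forall fun y => ?_
      have hl := s_lower (s := s) ht
      have hp := hm.trans_le hl
      rw [Real.norm_of_nonneg (gk_pos n hp _).le]
      refine (gk_le n hp _).trans ?_
      refine Real.rpow_le_rpow_of_nonpos (by positivity) (by gcongr) ?_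
      have : (0 : ℝ) ≤ n := Nat.cast_nonneg n
      linarith
    · refine Eventually.of_forall fun y => ?_
      unfold gaussKernel
      have hz : Tendsto (fun t : ℝ => x - Real.exp (-t / 2) • y) atTop (𝓝 x) := by
        have := (h2.smul_const y).const_sub x
        simpa using this
      refine Tendsto.mul ?_ ?_
      · refine Tendsto.rpow_const (h3.const_mul _) (Or.inl (by positivity))
      · refine (Real.continuous_exp.tendsto _).comp ?_
        exact ((hz.norm.pow 2).neg).div (h3.const_mul 2) (by norm_num)
  simpa using h

/-- Universality (Corollary): for every probability density `p_H` and every `ε > 0` there is a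
Gaussian-convolution approximant `p = φ_Σ ∗ μ` and a horizon `T > 0` with uniformly Lipschitz
scores on `[0,T]`, such that every bijective flow map of the associated VP probability flow
from `0` to `T` transporting `p` to `p_T` is bi-Lipschitz and its Gaussian pullback is
`ε`-close to `p_H` in total variation. -/
theorem stmt_13 (n : ℕ) (pH : EuclideanSpace ℝ (Fin n) → ℝ)
    (hnn : ∀ x, 0 ≤ pH x) (hint : Integrable pH) (hmass : ∫ x, pH x = 1) :
    ∀ ε : ℝ≥0∞, 0 < ε →
      ∃ (S : Matrix (Fin n) (Fin n) ℝ) (μ : Measure (EuclideanSpace ℝ (Fin n)))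
        (p : EuclideanSpace ℝ (Fin n) → ℝ) (T : ℝ),
        S.PosDef ∧ IsProbabilityMeasure μ ∧
        (∃ Kc : Set (EuclideanSpace ℝ (Fin n)), IsCompact Kc ∧ μ Kcᶜ = 0) ∧
        (∀ x, p x = ∫ y, gaussMat n S (x - y) ∂μ) ∧ 0 < T ∧
        (∀ t ∈ Set.Icc (0 : ℝ) T,
          (∀ x, 0 < vpMarginal n p t x) ∧
          TwiceDiff (fun x => Real.log (vpMarginal n p t x))) ∧
        (∃ M : ℝ, ∀ t ∈ Set.Icc (0 : ℝ) T, ∀ x,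
          ‖hessian (fun z => Real.log (vpMarginal n p t z)) x‖ ≤ M) ∧
        ∀ φ : EuclideanSpace ℝ (Fin n) → EuclideanSpace ℝ (Fin n),
          Function.Bijective φ →
          IsFlowMap n (vField n p) 0 T φ →
          Measure.map φ (densMeasure n p) = densMeasure n (vpMarginal n p T) →
          BiLipschitz φ ∧
            tvDist (densMeasure n pH)
              (Measure.map (Function.invFun φ) (stdGaussian n)) < ε := by

  intro ε hε
  obtain ⟨r, hr0, hrε⟩ := ENNReal.lt_iff_exists_nnreal_btwn.1 hε
  have hr0' : (0 : ℝ) < r := by exact_mod_cast hr0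
  set δ : ℝ := min (r / 8) (1 / 2) with hδd
  have hδ : 0 < δ := by positivity
  have hδr : 8 * δ ≤ r := by linarith [min_le_left ((r : ℝ) / 8) (1 / 2)]
  have hδ1 : δ ≤ 1 / 2 := min_le_right _ _
  obtain ⟨g, hgc, hgs, hg0, hgi, hg1, hgb⟩ :=
    exists_g n pH hnn hint hmass (half_pos hδ) (by linarith)
  set μ := densMeasure n g with hμ
  have hprob : IsProbabilityMeasure μ := by
    constructor
    rw [hμ, densMeasure, withDensity_apply _ MeasurableSet.univ, setLIntegral_univ,
      ← ofReal_integral_eq_lintegral_ofReal hgi (Eventually.of_forall hg0), hg1, ENNReal.ofReal_one]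
  have hsupp : μ (tsupport g)ᶜ = 0 := by
    have hmeas : MeasurableSet (tsupport g)ᶜ := (isClosed_tsupport g).measurableSet.compl
    rw [hμ, densMeasure, withDensity_apply _ hmeas]
    rw [setLIntegral_congr_fun (g := fun _ => 0) hmeas]
    · simp
    · intro x hx
      simp [image_eq_zero_of_notMem_tsupport hx]
  obtain ⟨R0, hR0⟩ := hgs.isCompact.isBounded.exists_norm_le
  have hR : ∀ᵐ y ∂μ, ‖y‖ ≤ max R0 0 := by
    have : ∀ᵐ y ∂μ, y ∈ tsupport g := by
      rw [ae_iff]; exact hsupp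
    filter_upwards [this] with y hy
    exact (hR0 y hy).trans (le_max_left _ _)
  -- choose the width
  have hsm := scheffe volume (l := 𝓝[>] (0 : ℝ)) (F := fun σ => mixQ n μ (σ ^ 2) 1) (f := g)
    (by
      filter_upwards [self_mem_nhdsWithin] with σ hσ
      have hσ2 : 0 < σ ^ 2 := pow_pos hσ 2
      exact ⟨(mix_integrable n μ hσ2).1, fun x => (mix_pos n μ hσ2 x).le,
        (mix_integrable n μ hσ2).2⟩)
    hgi hg0 hg1 (lim_small n hgc hgs hg0)
  obtain ⟨σ, hσb, hσ⟩ := ((hsm.eventually_lt_const hδ).and self_mem_nhdsWithin).exists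
  have hs : 0 < σ ^ 2 := pow_pos hσ 2
  set s := σ ^ 2 with hsd
  have hm : 0 < min s 1 := lt_min hs one_pos
  -- choose the horizon
  have hlg := scheffe volume (l := (atTop : Filter ℝ))
    (F := fun t => mixQ n μ (Real.exp (-t) * s + (1 - Real.exp (-t))) (Real.exp (-t / 2)))
    (f := gaussKernel n 1)
    (by
      filter_upwards [eventually_ge_atTop 0] with t ht
      have hp := hm.trans_le (s_lower (s := s) ht)
      exact ⟨(mix_integrable n μ hp).1, fun x => (mix_pos n μ hp x).le,
        (mix_integrable n μ hp).2⟩)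
    (gk_integrable n one_pos) (fun x => (gk_pos n one_pos x).le) (gk_integral n one_pos)
    (lim_large n μ hs)
  obtain ⟨T, hTb, hT⟩ := ((hlg.eventually_lt_const hδ).and (eventually_gt_atTop 0)).exists
  have hvp : ∀ t, 0 ≤ t → vpMarginal n (mixQ n μ s 1) t =
      mixQ n μ (Real.exp (-t) * s + (1 - Real.exp (-t))) (Real.exp (-t / 2)) :=
    fun t ht => funext fun x => vp_mix n μ hs ht x
  have hH : ∀ t ∈ Set.Icc (0 : ℝ) T,
      TwiceDiff (fun x => Real.log (vpMarginal n (mixQ n μ s 1) t x)) ∧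
      ∀ x, ‖hessian (fun z => Real.log (vpMarginal n (mixQ n μ s 1) t z)) x‖ ≤
        1 / min s 1 + 2 * (max R0 0 / min s 1) ^ 2 := by
    intro t ht
    rw [hvp t ht.1]
    refine mix_hess n μ hm (s_lower ht.1) (Real.exp_pos _).le ?_ (le_max_right _ _) hR
    rw [Real.exp_le_one_iff]; linarith [ht.1]
  refine ⟨s • 1, μ, mixQ n μ s 1, T, Matrix.PosDef.one.smul hs, hprob, ⟨tsupport g, hgs.isCompact, hsupp⟩,
    fun x => ?_, hT, fun t ht => ⟨fun x => ?_, (hH t ht).1⟩, ⟨_, fun t ht => (hH t ht).2⟩, ?_⟩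
  · simp only [mixQ, gaussMat_smul n hs, one_smul]
  · rw [hvp t ht.1]
    exact mix_pos n μ (hm.trans_le (s_lower ht.1)) x
  intro φ hbij hflow htr
  have hbl : BiLipschitz φ := by
    refine flow_bilip n (vField n (mixQ n μ s 1)) hT
      (1 + Real.toNNReal (1 / min s 1 + 2 * (max R0 0 / min s 1) ^ 2)) (fun t ht => ?_) φ hflow
    refine vField_lip n _ t _ (hH t ht).1 fun x => ((hH t ht).2 x).trans ?_
    exact Real.le_coe_toNNReal _
  refine ⟨hbl, ?_⟩
  obtain ⟨c, C, hc, hcC, hcl⟩ := hbl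
  have hφc : Continuous φ := by
    refine (LipschitzWith.of_dist_le_mul (K := Real.toNNReal C) fun x y => ?_).continuous
    rw [dist_eq_norm, dist_eq_norm, Real.coe_toNNReal _ (hc.le.trans hcC)]
    exact (hcl x y).2
  have hli : Function.LeftInverse (Function.invFun φ) φ := Function.leftInverse_invFun hbij.1
  have hri : Function.RightInverse (Function.invFun φ) φ := Function.rightInverse_invFun hbij.2
  have hψc : Continuous (Function.invFun φ) := by
    refine (LipschitzWith.of_dist_le_mul (K := Real.toNNReal c⁻¹) fun x y => ?_).continuous
    rw [dist_eq_norm, dist_eq_norm, Real.coe_toNNReal _ (by positivity)]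
    have := (hcl (Function.invFun φ x) (Function.invFun φ y)).1
    rw [hri x, hri y] at this
    rwa [inv_mul_eq_div, le_div_iff₀' hc]
  have hback : densMeasure n (mixQ n μ s 1) =
      Measure.map (Function.invFun φ) (densMeasure n (vpMarginal n (mixQ n μ s 1) T)) := by
    rw [← htr, Measure.map_map hψc.measurable hφc.measurable, hli.comp_eq_id, Measure.map_id]
  have hpi := (mix_integrable n μ (a := 1) hs).1
  have hTi := (mix_integrable n μ (a := Real.exp (-T / 2))
    (hm.trans_le (s_lower (s := s) hT.le))).1
  have t1 := tv_dens n hint hgi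
  have t2 := tv_dens n hgi hpi
  have t3 := (tv_map (densMeasure n (vpMarginal n (mixQ n μ s 1) T)) (stdGaussian n)
    (Function.invFun φ) hψc.measurable)
  rw [← hback] at t3
  have t4 := tv_dens n hTi (gk_integrable n one_pos)
  rw [hvp T hT.le] at t3
  have e2 : ∫ x, |g x - mixQ n μ s 1 x| = ∫ x, |mixQ n μ s 1 x - g x| := by
    simp_rw [abs_sub_comm]
  rw [e2] at t2
  have t1' := t1.trans (ENNReal.ofReal_le_ofReal (show _ ≤ 2 * δ by linarith))
  have t2' := t2.trans (ENNReal.ofReal_le_ofReal (show _ ≤ 2 * δ by linarith))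
  have t3' := (t3.trans t4).trans (ENNReal.ofReal_le_ofReal (show _ ≤ 2 * δ by linarith))
  calc _ ≤ tvDist (densMeasure n pH) (densMeasure n g) +
        (tvDist (densMeasure n g) (densMeasure n (mixQ n μ s 1)) +
        tvDist (densMeasure n (mixQ n μ s 1)) (Measure.map (Function.invFun φ) (stdGaussian n))) :=
        (tv_tri _ (densMeasure n g) _).trans (add_le_add le_rfl (tv_tri _ _ _))
    _ ≤ ENNReal.ofReal (2 * δ) + (ENNReal.ofReal (2 * δ) + ENNReal.ofReal (2 * δ)) :=
        add_le_add t1' (add_le_add t2' t3')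
    _ = ENNReal.ofReal (6 * δ) := by
        rw [← ENNReal.ofReal_add (by positivity) (by positivity),
          ← ENNReal.ofReal_add (by positivity) (by positivity)]
        congr 1; ring
    _ ≤ r := by
        rw [← ENNReal.ofReal_coe_nnreal]
        exact ENNReal.ofReal_le_ofReal (by linarith)
    _ < ε := hrε
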